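/- Fix λ ≥ 0, a cost vector s ≥ 0 and a classical-quantum channel (ρ_x)_{x∈X}. Let (p^t)_{t≥0} be the Blahut–Arimoto iterates started from a strictly positive p^0, and let p* be any maximizer of p ↦ f_λ(p, p) over Δ_n with supp(p*) ⊆ supp(p^0). Then for every N ≥ 0: Σ_{t=0}^N [F(λ) − f_λ(p^{t+1}, p^t)] ≤ D(p*‖p^0) − D(p*‖p^{N+1}) ≤ D(p*‖p^0), where F(λ) = f_λ(p*, p*). -/

import Mathlib

open Matrix Finset Filter ComplexOrder

/-- Matrix logarithm on the support: for a Hermitian matrix, apply `Real.log`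
to the eigenvalues (note `Real.log 0 = 0`, giving the logarithm on the support);
junk value `0` otherwise. -/
noncomputable def mlog {k : ℕ} (A : Matrix (Fin k) (Fin k) ℂ) : Matrix (Fin k) (Fin k) ℂ :=
  if h : A.IsHermitian then
    (h.eigenvectorUnitary : Matrix (Fin k) (Fin k) ℂ) *
      Matrix.diagonal (fun i => (Real.log (h.eigenvalues i) : ℂ)) *
      (star (h.eigenvectorUnitary : Matrix (Fin k) (Fin k) ℂ))
  else 0

/-- A density matrix: positive semidefinite with unit trace. -/
def IsDensity {k : ℕ} (ρ : Matrix (Fin k) (Fin k) ℂ) : Prop :=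
  ρ.PosSemidef ∧ ρ.trace = 1

/-- A probability distribution on `Fin k`. -/
def IsDist {k : ℕ} (p : Fin k → ℝ) : Prop :=
  (∀ x, 0 ≤ p x) ∧ ∑ x, p x = 1

/-- `supp ρ ⊆ supp σ`, expressed as `ker σ ⊆ ker ρ`. -/
def SuppLE {k : ℕ} (ρ σ : Matrix (Fin k) (Fin k) ℂ) : Prop :=
  ∀ v, σ.mulVec v = 0 → ρ.mulVec v = 0

/-- Quantum relative entropy `D(ρ‖σ) = Tr[ρ(log ρ − log σ)]` (natural log). -/
noncomputable def qRelEnt {k : ℕ} (ρ σ : Matrix (Fin k) (Fin k) ℂ) : ℝ :=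
  (Matrix.trace (ρ * (mlog ρ - mlog σ))).re

/-- Von Neumann entropy `H(ρ) = −Tr(ρ log ρ)` (natural log). -/
noncomputable def vN {k : ℕ} (ρ : Matrix (Fin k) (Fin k) ℂ) : ℝ :=
  -(Matrix.trace (ρ * mlog ρ)).re

/-- Classical relative entropy `D(p‖q)`. -/
noncomputable def cRelEnt {k : ℕ} (p q : Fin k → ℝ) : ℝ :=
  ∑ x, p x * (Real.log (p x) - Real.log (q x))

/-- Holevo quantity `χ(p) = H(Σ_x p_x ρ_x) − Σ_x p_x H(ρ_x)`. -/
noncomputable def holevo {n m : ℕ} (ρ : Fin n → Matrix (Fin m) (Fin m) ℂ)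
    (p : Fin n → ℝ) : ℝ :=
  vN (∑ x, (p x : ℂ) • ρ x) - ∑ x, p x * vN (ρ x)

/-- `f_λ(p, p') = Σ_x Tr{p_x ρ_x [log(p'_x ρ_x) − log(p_x ρ')]} − λ sᵀp`,
where `ρ' = Σ_x p'_x ρ_x`. -/
noncomputable def fBA {n m : ℕ} (ρ : Fin n → Matrix (Fin m) (Fin m) ℂ)
    (s : Fin n → ℝ) (lam : ℝ) (p p' : Fin n → ℝ) : ℝ :=
  (∑ x, (Matrix.trace (((p x : ℂ) • ρ x) *
      (mlog ((p' x : ℂ) • ρ x) - mlog ((p x : ℂ) • ∑ y, (p' y : ℂ) • ρ y)))).re)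
    - lam * ∑ x, s x * p x

/-- `r_x = exp(Tr{ρ_x[log(p_x ρ_x) − log ρ̄]} − λ s_x)` with `ρ̄ = Σ_y p_y ρ_y`. -/
noncomputable def rBA {n m : ℕ} (ρ : Fin n → Matrix (Fin m) (Fin m) ℂ)
    (s : Fin n → ℝ) (lam : ℝ) (p : Fin n → ℝ) (x : Fin n) : ℝ :=
  Real.exp ((Matrix.trace (ρ x *
      (mlog ((p x : ℂ) • ρ x) - mlog (∑ y, (p y : ℂ) • ρ y)))).re - lam * s x)

/-- One Blahut–Arimoto update step. -/
noncomputable def baStep {n m : ℕ} (ρ : Fin n → Matrix (Fin m) (Fin m) ℂ)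
    (s : Fin n → ℝ) (lam : ℝ) (p : Fin n → ℝ) (x : Fin n) : ℝ :=
  rBA ρ s lam p x / ∑ y, rBA ρ s lam p y

/-- The Blahut–Arimoto iterates starting from `p0`. -/
noncomputable def baSeq {n m : ℕ} (ρ : Fin n → Matrix (Fin m) (Fin m) ℂ)
    (s : Fin n → ℝ) (lam : ℝ) (p0 : Fin n → ℝ) : ℕ → Fin n → ℝ
  | 0 => p0
  | t + 1 => baStep ρ s lam (baSeq ρ s lam p0 t)

/-- The orthogonal projection onto the kernel of a Hermitian matrix. -/
noncomputable def kerProj {k : ℕ} (A : Matrix (Fin k) (Fin k) ℂ) : Matrix (Fin k) (Fin k) ℂ :=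
  cfc (fun x : ℝ => if x = 0 then (1 : ℝ) else 0) A

/-- The mixture of a family of matrices with weights `p`. -/
noncomputable def mixture {n m : ℕ} (ρ : Fin n → Matrix (Fin m) (Fin m) ℂ) (p : Fin n → ℝ) :
    Matrix (Fin m) (Fin m) ℂ :=
  ∑ y, (p y : ℂ) • ρ y

section MatrixLog

variable {k : ℕ} {A B : Matrix (Fin k) (Fin k) ℂ}

lemma continuousOn_spectrum_matrix (f : ℝ → ℝ) (A : Matrix (Fin k) (Fin k) ℂ) :
    ContinuousOn f (spectrum ℝ A) :=
  A.finite_real_spectrum.continuousOn f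

lemma mlog_eq_cfc (hA : A.IsHermitian) : mlog A = cfc Real.log A := by
  rw [hA.cfc_eq, mlog, dif_pos hA, Matrix.IsHermitian.cfc, Unitary.conjStarAlgAut_apply]
  rfl

lemma mlog_smul (hA : A.IsHermitian) {c : ℝ} (hc : 0 < c) :
    mlog ((c : ℂ) • A) = mlog A + (Real.log c : ℂ) • (1 - kerProj A) := by
  have hsm : ∀ (d : ℝ) (M : Matrix (Fin k) (Fin k) ℂ), (d : ℂ) • M = d • M :=
    fun d M => Complex.coe_smul d M
  have hA' : IsSelfAdjoint A := hA
  rw [hsm, hsm, mlog_eq_cfc hA, mlog_eq_cfc (IsSelfAdjoint.smul (IsSelfAdjoint.all c) hA'),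
    kerProj, ← cfc_comp_smul c Real.log A ((A.finite_real_spectrum.image _).continuousOn _) hA',
    ← cfc_one ℝ A hA', ← cfc_sub _ _ A (continuousOn_spectrum_matrix _ A)
      (continuousOn_spectrum_matrix _ A),
    ← cfc_smul _ _ A (continuousOn_spectrum_matrix _ A),
    ← cfc_add A _ _ (continuousOn_spectrum_matrix _ A) (continuousOn_spectrum_matrix _ A)]
  refine cfc_congr fun x _ => ?_
  by_cases hx : x = 0
  · simp [hx]
  · simp [hx, Real.log_mul hc.ne' hx, add_comm]

lemma mul_kerProj (hA : A.IsHermitian) : A * kerProj A = 0 := by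
  have hA' : IsSelfAdjoint A := hA
  have h := cfc_mul (fun x : ℝ => x) (fun x : ℝ => if x = 0 then (1 : ℝ) else 0) A
    (continuousOn_spectrum_matrix _ A) (continuousOn_spectrum_matrix _ A)
  rw [cfc_id' ℝ A hA'] at h
  rw [kerProj, ← h, ← cfc_zero ℝ A]
  refine cfc_congr fun x _ => ?_
  by_cases hx : x = 0 <;> simp [hx]

lemma SuppLE.mul_eq_zero (h : SuppLE A B) {C : Matrix (Fin k) (Fin k) ℂ} (hC : B * C = 0) :
    A * C = 0 := by
  ext i j
  exact congrFun (h (fun l => C l j) (funext fun i => congrFun (congrFun hC i) j)) i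

lemma trace_mul_mlog_smul (hB : B.IsHermitian) (h : SuppLE A B) {c : ℝ} (hc : 0 < c) :
    (A * mlog ((c : ℂ) • B)).trace.re = (A * mlog B).trace.re + Real.log c * A.trace.re := by
  rw [mlog_smul hB hc, mul_add, Matrix.mul_smul, mul_sub, h.mul_eq_zero (mul_kerProj hB)]
  simp

lemma trace_cfc_mul_cfc (hA : A.IsHermitian) (hB : B.IsHermitian) (f g : ℝ → ℝ) :
    (cfc f A * cfc g B).trace.re =
      ∑ i, ∑ j, f (hA.eigenvalues i) * g (hB.eigenvalues j) *
        Complex.normSq ((star (hA.eigenvectorUnitary : Matrix (Fin k) (Fin k) ℂ) *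
          (hB.eigenvectorUnitary : Matrix (Fin k) (Fin k) ℂ)) i j) := by
  rw [hA.cfc_eq, hB.cfc_eq, Matrix.IsHermitian.cfc, Matrix.IsHermitian.cfc,
    Unitary.conjStarAlgAut_apply, Unitary.conjStarAlgAut_apply]
  set U := (hA.eigenvectorUnitary : Matrix (Fin k) (Fin k) ℂ)
  set V := (hB.eigenvectorUnitary : Matrix (Fin k) (Fin k) ℂ)
  have hW : star V * U = star (star U * V) := by simp
  rw [mul_assoc, mul_assoc, Matrix.trace_mul_comm]
  have : diagonal (RCLike.ofReal ∘ f ∘ hA.eigenvalues) *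
      (star U * (V * diagonal (RCLike.ofReal ∘ g ∘ hB.eigenvalues) * star V)) * U =
      diagonal (RCLike.ofReal ∘ f ∘ hA.eigenvalues) * (star U * V) *
        (diagonal (RCLike.ofReal ∘ g ∘ hB.eigenvalues) * star (star U * V)) := by
    rw [← hW]; simp only [mul_assoc]
  rw [this]
  simp only [Matrix.trace, Matrix.diag_apply, Complex.re_sum]
  refine Finset.sum_congr rfl fun i _ => ?_
  rw [Matrix.mul_apply, Complex.re_sum]
  refine Finset.sum_congr rfl fun j _ => ?_
  rw [Matrix.diagonal_mul, Matrix.diagonal_mul, Matrix.star_apply]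
  simp only [Function.comp_apply, Complex.coe_algebraMap, Complex.normSq_apply, RCLike.star_def,
    Complex.mul_re, Complex.mul_im, Complex.conj_re, Complex.conj_im,
    Complex.ofReal_re, Complex.ofReal_im]
  ring

/-- **Klein's inequality**: the quantum relative entropy of density matrices is nonnegative. -/
lemma qRelEnt_nonneg (hA : IsDensity A) (hB : IsDensity B) (h : SuppLE A B) :
    0 ≤ qRelEnt A B := by
  have hA' := hA.1.isHermitian
  have hB' := hB.1.isHermitian
  have sA : IsSelfAdjoint A := hA'
  have sB : IsSelfAdjoint B := hB'
  have tr := trace_cfc_mul_cfc hA' hB'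
  set P : Fin k → Fin k → ℝ := fun i j =>
    Complex.normSq ((star (hA'.eigenvectorUnitary : Matrix (Fin k) (Fin k) ℂ) *
          (hB'.eigenvectorUnitary : Matrix (Fin k) (Fin k) ℂ)) i j) with hP
  have hP0 : ∀ i j, 0 ≤ P i j := fun i j => Complex.normSq_nonneg _
  have ha := hA.1.eigenvalues_nonneg
  have hb := hB.1.eigenvalues_nonneg
  set a := hA'.eigenvalues
  set b := hB'.eigenvalues
  have t1 : ∑ i, ∑ j, a i * P i j = 1 := by
    have := tr (fun x => x) (fun _ => 1)
    rw [cfc_id' ℝ A sA, cfc_const_one ℝ B sB, mul_one, hA.2] at this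
    simpa using this.symm
  have t2 : ∑ i, ∑ j, b j * P i j = 1 := by
    have := tr (fun _ => 1) (fun x => x)
    rw [cfc_id' ℝ B sB, cfc_const_one ℝ A sA, one_mul, hB.2] at this
    simpa using this.symm
  have t3 : (A * mlog A).trace.re = ∑ i, ∑ j, a i * Real.log (a i) * P i j := by
    have := tr (fun x => x * Real.log x) (fun _ => 1)
    rw [cfc_mul (fun x => x) Real.log A (continuousOn_spectrum_matrix _ A)
      (continuousOn_spectrum_matrix _ A), cfc_id' ℝ A sA, cfc_const_one ℝ B sB, mul_one,
      ← mlog_eq_cfc hA'] at this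
    simpa using this
  have t4 : (A * mlog B).trace.re = ∑ i, ∑ j, a i * Real.log (b j) * P i j := by
    have := tr (fun x => x) Real.log
    rwa [cfc_id' ℝ A sA, ← mlog_eq_cfc hB'] at this
  have t5 : ∀ i j, b j = 0 → a i * P i j = 0 := by
    have := tr (fun x => x) (fun x => if x = 0 then 1 else 0)
    rw [cfc_id' ℝ A sA, ← kerProj, h.mul_eq_zero (mul_kerProj hB')] at this
    have hn : ∀ i j, 0 ≤ a i * (if b j = 0 then 1 else 0) * P i j := fun i j =>
      mul_nonneg (mul_nonneg (ha i) (by split_ifs <;> simp)) (hP0 i j)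
    have h0 := (Finset.sum_eq_zero_iff_of_nonneg
      (fun i _ => Finset.sum_nonneg fun j _ => hn i j)).1 (by simpa using this.symm)
    intro i j hj
    have h1 := (Finset.sum_eq_zero_iff_of_nonneg (fun j _ => hn i j)).1
      (h0 i (Finset.mem_univ i)) j (Finset.mem_univ j)
    simpa [hj] using h1
  have key : ∀ i j, a i * P i j - b j * P i j ≤
      a i * Real.log (a i) * P i j - a i * Real.log (b j) * P i j := by
    intro i j
    rcases (hb j).eq_or_lt with hj | hj
    · have := t5 i j hj.symm
      have e : a i * Real.log (a i) * P i j = Real.log (a i) * (a i * P i j) := by ring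
      rw [e, this, ← hj]
      simp
    rcases (ha i).eq_or_lt with hi | hi
    · rw [← hi]
      have := mul_nonneg hj.le (hP0 i j)
      simpa using this
    have hl := Real.log_le_sub_one_of_pos (div_pos hj hi)
    rw [Real.log_div hj.ne' hi.ne'] at hl
    have h2 : a i * (Real.log (b j) - Real.log (a i)) ≤ b j - a i := by
      calc _ ≤ a i * (b j / a i - 1) := mul_le_mul_of_nonneg_left hl hi.le
        _ = b j - a i := by field_simp
    nlinarith [mul_le_mul_of_nonneg_right h2 (hP0 i j)]
  have hsum := Finset.sum_le_sum fun i (_ : i ∈ Finset.univ) =>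
    Finset.sum_le_sum fun j (_ : j ∈ Finset.univ) => key i j
  simp only [Finset.sum_sub_distrib] at hsum
  rw [t1, t2, ← t3, ← t4, sub_self] at hsum
  simpa [qRelEnt, mul_sub] using hsum

end MatrixLog

section Channel

variable {n m : ℕ} {ρ : Fin n → Matrix (Fin m) (Fin m) ℂ} {p q : Fin n → ℝ}

lemma posSemidef_mixture (hρ : ∀ x, IsDensity (ρ x)) (hp : ∀ x, 0 ≤ p x) :
    (mixture ρ p).PosSemidef :=
  Matrix.posSemidef_sum _ fun x _ => (hρ x).1.smul (by exact_mod_cast hp x)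

lemma isDensity_mixture (hρ : ∀ x, IsDensity (ρ x)) (hp : IsDist p) :
    IsDensity (mixture ρ p) := by
  refine ⟨posSemidef_mixture hρ hp.1, ?_⟩
  simp only [mixture, Matrix.trace_sum, Matrix.trace_smul, (hρ _).2, smul_eq_mul, mul_one]
  exact_mod_cast hp.2

lemma suppLE_mixture (hρ : ∀ x, IsDensity (ρ x)) (hp : ∀ x, 0 ≤ p x) {x : Fin n}
    (hx : 0 < p x) : SuppLE (ρ x) (mixture ρ p) := by
  intro v hv
  have hpos : ∀ y, ((p y : ℂ) • ρ y).PosSemidef := fun y =>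
    (hρ y).1.smul (by exact_mod_cast hp y)
  have h0 : ∑ y, star v ⬝ᵥ (((p y : ℂ) • ρ y) *ᵥ v) = 0 := by
    rw [← dotProduct_sum, ← Matrix.sum_mulVec]
    change star v ⬝ᵥ (mixture ρ p *ᵥ v) = 0
    rw [hv, dotProduct_zero]
  have h1 := (Finset.sum_eq_zero_iff_of_nonneg
    (fun y _ => (hpos y).dotProduct_mulVec_nonneg v)).1 h0 x (Finset.mem_univ x)
  rw [(hpos x).dotProduct_mulVec_zero_iff, Matrix.smul_mulVec] at h1
  exact (smul_eq_zero.1 h1).resolve_left (by exact_mod_cast hx.ne')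

lemma suppLE_mixture_mixture (hρ : ∀ x, IsDensity (ρ x)) (hq : ∀ x, 0 < q x) (p : Fin n → ℝ) :
    SuppLE (mixture ρ p) (mixture ρ q) := by
  intro v hv
  rw [mixture, Matrix.sum_mulVec]
  refine Finset.sum_eq_zero fun x _ => ?_
  rw [Matrix.smul_mulVec, suppLE_mixture hρ (fun y => (hq y).le) (hq x) v hv, smul_zero]

lemma suppLE_refl {k : ℕ} (A : Matrix (Fin k) (Fin k) ℂ) : SuppLE A A := fun _ h => h

lemma fBA_eq (hρ : ∀ x, IsDensity (ρ x)) (s : Fin n → ℝ) (lam : ℝ) (hp : ∀ x, 0 ≤ p x)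
    (hq : ∀ x, 0 ≤ q x) (hpq : ∀ x, 0 < p x → 0 < q x) :
    fBA ρ s lam p q = ∑ x, p x * (Real.log (q x) - Real.log (p x) +
      (qRelEnt (ρ x) (mixture ρ q) - lam * s x)) := by
  rw [fBA, Finset.mul_sum, ← Finset.sum_sub_distrib]
  refine Finset.sum_congr rfl fun x _ => ?_
  rcases (hp x).eq_or_lt with hx | hx
  · simp [← hx]
  have hqx := hpq x hx
  have e1 := trace_mul_mlog_smul (hρ x).1.isHermitian (suppLE_refl (ρ x)) hqx
  have e2 := trace_mul_mlog_smul (posSemidef_mixture hρ hq).isHermitian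
    (suppLE_mixture hρ hq hqx) hx
  rw [(hρ x).2] at e1 e2
  change (Matrix.trace (((p x : ℂ) • ρ x) * (mlog ((q x : ℂ) • ρ x) -
    mlog ((p x : ℂ) • mixture ρ q)))).re - _ = _
  rw [Matrix.smul_mul, Matrix.trace_smul, smul_eq_mul, Complex.re_ofReal_mul, mul_sub,
    Matrix.trace_sub, Complex.sub_re, e1, e2, qRelEnt, mul_sub (ρ x), Matrix.trace_sub,
    Complex.sub_re, Complex.one_re]
  ring

lemma log_rBA (hρ : ∀ x, IsDensity (ρ x)) (s : Fin n → ℝ) (lam : ℝ) {x : Fin n}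
    (hx : 0 < q x) :
    Real.log (rBA ρ s lam q x) =
      Real.log (q x) + (qRelEnt (ρ x) (mixture ρ q) - lam * s x) := by
  have e1 := trace_mul_mlog_smul (hρ x).1.isHermitian (suppLE_refl (ρ x)) hx
  rw [(hρ x).2] at e1
  rw [rBA, Real.log_exp, mul_sub, Matrix.trace_sub, Complex.sub_re, e1, qRelEnt, mul_sub,
    Matrix.trace_sub, Complex.sub_re, Complex.one_re, mixture]
  ring

lemma rBA_pos (ρ : Fin n → Matrix (Fin m) (Fin m) ℂ) (s : Fin n → ℝ) (lam : ℝ)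
    (q : Fin n → ℝ) (x : Fin n) : 0 < rBA ρ s lam q x :=
  Real.exp_pos _

lemma sum_rBA_pos [Nonempty (Fin n)] (ρ : Fin n → Matrix (Fin m) (Fin m) ℂ) (s : Fin n → ℝ)
    (lam : ℝ) (q : Fin n → ℝ) : 0 < ∑ x, rBA ρ s lam q x :=
  Finset.sum_pos (fun x _ => rBA_pos ρ s lam q x) Finset.univ_nonempty

lemma baStep_pos [Nonempty (Fin n)] (ρ : Fin n → Matrix (Fin m) (Fin m) ℂ) (s : Fin n → ℝ)
    (lam : ℝ) (q : Fin n → ℝ) (x : Fin n) : 0 < baStep ρ s lam q x :=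
  div_pos (rBA_pos ρ s lam q x) (sum_rBA_pos ρ s lam q)

lemma sum_baStep [Nonempty (Fin n)] (ρ : Fin n → Matrix (Fin m) (Fin m) ℂ) (s : Fin n → ℝ)
    (lam : ℝ) (q : Fin n → ℝ) : ∑ x, baStep ρ s lam q x = 1 := by
  simp only [baStep, ← Finset.sum_div]
  exact div_self (sum_rBA_pos ρ s lam q).ne'

lemma log_baStep [Nonempty (Fin n)] (hρ : ∀ x, IsDensity (ρ x)) (s : Fin n → ℝ) (lam : ℝ)
    {x : Fin n} (hx : 0 < q x) :
    Real.log (baStep ρ s lam q x) = Real.log (q x) +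
      (qRelEnt (ρ x) (mixture ρ q) - lam * s x) - Real.log (∑ y, rBA ρ s lam q y) := by
  rw [baStep, Real.log_div (rBA_pos ρ s lam q x).ne' (sum_rBA_pos ρ s lam q).ne',
    log_rBA hρ s lam hx]

lemma fBA_baStep [Nonempty (Fin n)] (hρ : ∀ x, IsDensity (ρ x)) (s : Fin n → ℝ) (lam : ℝ)
    (hq : ∀ x, 0 < q x) :
    fBA ρ s lam (baStep ρ s lam q) q = Real.log (∑ y, rBA ρ s lam q y) := by
  rw [fBA_eq hρ s lam (fun x => (baStep_pos ρ s lam q x).le) (fun x => (hq x).le)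
    (fun x _ => hq x)]
  have : ∀ x, baStep ρ s lam q x * (Real.log (q x) - Real.log (baStep ρ s lam q x) +
      (qRelEnt (ρ x) (mixture ρ q) - lam * s x)) =
      baStep ρ s lam q x * Real.log (∑ y, rBA ρ s lam q y) := by
    intro x
    rw [log_baStep hρ s lam (hq x)]
    ring
  rw [Finset.sum_congr rfl fun x _ => this x, ← Finset.sum_mul, sum_baStep, one_mul]

lemma sum_mul_trace_mul_re (p : Fin n → ℝ) (C : Matrix (Fin m) (Fin m) ℂ) :
    ∑ x, p x * (ρ x * C).trace.re = (mixture ρ p * C).trace.re := by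
  simp [mixture, Finset.sum_mul, Matrix.trace_sum]

lemma sum_mul_qRelEnt_le (hρ : ∀ x, IsDensity (ρ x)) (hp : IsDist p) (hq : IsDist q)
    (hq0 : ∀ x, 0 < q x) :
    ∑ x, p x * qRelEnt (ρ x) (mixture ρ p) ≤ ∑ x, p x * qRelEnt (ρ x) (mixture ρ q) := by
  have h := qRelEnt_nonneg (isDensity_mixture hρ hp) (isDensity_mixture hρ hq)
    (suppLE_mixture_mixture hρ hq0 p)
  simp only [qRelEnt, mul_sub, Matrix.trace_sub, Complex.sub_re, Finset.sum_sub_distrib,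
    sum_mul_trace_mul_re] at h ⊢
  linarith

lemma fBA_sub_fBA_baStep_le [Nonempty (Fin n)] (hρ : ∀ x, IsDensity (ρ x)) (s : Fin n → ℝ)
    (lam : ℝ) (hp : IsDist p) (hq : IsDist q) (hq0 : ∀ x, 0 < q x) :
    fBA ρ s lam p p - fBA ρ s lam (baStep ρ s lam q) q ≤
      cRelEnt p q - cRelEnt p (baStep ρ s lam q) := by
  have h := sum_mul_qRelEnt_le hρ hp hq hq0
  rw [fBA_baStep hρ s lam hq0, fBA_eq hρ s lam hp.1 hp.1 fun _ hx => hx, cRelEnt, cRelEnt,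
    ← Finset.sum_sub_distrib]
  simp only [log_baStep hρ s lam (hq0 _)]
  have e : ∀ x, p x * (Real.log (p x) - Real.log (q x)) - p x * (Real.log (p x) -
      (Real.log (q x) + (qRelEnt (ρ x) (mixture ρ q) - lam * s x) -
        Real.log (∑ y, rBA ρ s lam q y))) =
      p x * qRelEnt (ρ x) (mixture ρ q) - p x * (lam * s x) -
        p x * Real.log (∑ y, rBA ρ s lam q y) := fun x => by ring
  rw [Finset.sum_congr rfl fun x _ => e x]
  simp only [sub_self, zero_add, mul_sub, Finset.sum_sub_distrib, ← Finset.sum_mul, hp.2, one_mul]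
  linarith

lemma cRelEnt_nonneg (hp : IsDist p) (hq : IsDist q) (hq0 : ∀ x, 0 < q x) :
    0 ≤ cRelEnt p q := by
  have key : ∀ x, p x - q x ≤ p x * (Real.log (p x) - Real.log (q x)) := by
    intro x
    rcases (hp.1 x).eq_or_lt with hx | hx
    · simpa [← hx] using hq.1 x
    have hl := Real.log_le_sub_one_of_pos (div_pos (hq0 x) hx)
    rw [Real.log_div (hq0 x).ne' hx.ne'] at hl
    have h2 : p x * (Real.log (q x) - Real.log (p x)) ≤ q x - p x := by
      calc _ ≤ p x * (q x / p x - 1) := mul_le_mul_of_nonneg_left hl hx.le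
        _ = q x - p x := by field_simp
    linarith
  have := Finset.sum_le_sum fun x (_ : x ∈ Finset.univ) => key x
  rwa [Finset.sum_sub_distrib, hp.2, hq.2, sub_self] at this

lemma isDist_baSeq [Nonempty (Fin n)] (ρ : Fin n → Matrix (Fin m) (Fin m) ℂ) (s : Fin n → ℝ)
    (lam : ℝ) (hp : IsDist p) (hp0 : ∀ x, 0 < p x) (t : ℕ) :
    IsDist (baSeq ρ s lam p t) ∧ ∀ x, 0 < baSeq ρ s lam p t x := by
  cases t with
  | zero => exact ⟨hp, hp0⟩
  | succ t =>
    exact ⟨⟨fun x => (baStep_pos ρ s lam _ x).le, sum_baStep ρ s lam _⟩, baStep_pos ρ s lam _⟩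

end Channel

/-- telescoping bound inside Theorem 2: for BA iterates from a
strictly positive `p⁰` and `p*` a maximizer of `p ↦ f_λ(p,p)`,
`Σ_{t=0}^N [F(λ) − f_λ(p^{t+1},p^t)] ≤ D(p*‖p⁰) − D(p*‖p^{N+1}) ≤ D(p*‖p⁰)`
where `F(λ) = f_λ(p*,p*)`. -/
theorem stmt_8 {n m : ℕ} (lam : ℝ) (hlam : 0 ≤ lam)
    (s : Fin n → ℝ) (hs : ∀ x, 0 ≤ s x)
    (ρ : Fin n → Matrix (Fin m) (Fin m) ℂ) (hρ : ∀ x, IsDensity (ρ x))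
    (p0 : Fin n → ℝ) (hp0 : IsDist p0) (hp0pos : ∀ x, 0 < p0 x)
    (pstar : Fin n → ℝ) (hps : IsDist pstar)
    (hmax : ∀ q : Fin n → ℝ, IsDist q → fBA ρ s lam q q ≤ fBA ρ s lam pstar pstar) :
    ∀ N : ℕ,
      (∑ t ∈ Finset.range (N + 1),
          (fBA ρ s lam pstar pstar -
            fBA ρ s lam (baSeq ρ s lam p0 (t + 1)) (baSeq ρ s lam p0 t))) ≤
        cRelEnt pstar p0 - cRelEnt pstar (baSeq ρ s lam p0 (N + 1)) ∧
      cRelEnt pstar p0 - cRelEnt pstar (baSeq ρ s lam p0 (N + 1)) ≤ cRelEnt pstar p0 := by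
  intro N
  have : Nonempty (Fin n) := by
    by_contra hne
    rw [not_nonempty_iff] at hne
    simpa using hp0.2
  have hseq := isDist_baSeq ρ s lam hp0 hp0pos
  refine ⟨?_, sub_le_self _ (cRelEnt_nonneg hps (hseq _).1 (hseq _).2)⟩
  calc _ ≤ ∑ t ∈ Finset.range (N + 1), (cRelEnt pstar (baSeq ρ s lam p0 t) -
        cRelEnt pstar (baSeq ρ s lam p0 (t + 1))) :=
        Finset.sum_le_sum fun t _ =>
          fBA_sub_fBA_baStep_le hρ s lam hps (hseq t).1 (hseq t).2
    _ = _ := Finset.sum_range_sub' (fun t => cRelEnt pstar (baSeq ρ s lam p0 t)) (N + 1)
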